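/- Characterization lemma for two-way HAA: for every two-way HAA A over Σ and every pointed word (w,ℓ), (w,ℓ) ∈ L_p(A) if and only if there exists an accepting infinite sequence of regions of A that is good with respect to (w,ℓ). -/

import Mathlib

/-- Directions for two-way automata: forward and backward moves. -/
inductive TDir where
  | fwd : TDir
  | bwd : TDir
deriving DecidableEq

/-- Positive boolean formulas over `α` (with `true` and `false` allowed). -/
inductive PosBool (α : Type) where
  | tt : PosBool α
  | ff : PosBool α
  | var : α → PosBool α
  | and : PosBool α → PosBool α → PosBool α
  | or : PosBool α → PosBool α → PosBool α

/-- Satisfaction of a positive boolean formula by a set. -/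
def PosBool.isSat {α : Type} : PosBool α → Set α → Prop
  | .tt, _ => True
  | .ff, _ => False
  | .var a, Y => a ∈ Y
  | .and f g, Y => PosBool.isSat f Y ∧ PosBool.isSat g Y
  | .or f g, Y => PosBool.isSat f Y ∨ PosBool.isSat g Y

/-- `Y` is a minimal model of `f`. -/
def PosBool.MinModel {α : Type} (f : PosBool α) (Y : Set α) : Prop :=
  PosBool.isSat f Y ∧ ∀ Z : Set α, Z ⊂ Y → ¬ PosBool.isSat f Z

/-- The atom `a` occurs in the positive boolean formula. -/
def PosBool.occurs {α : Type} (a : α) : PosBool α → Prop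
  | .tt => False
  | .ff => False
  | .var b => b = a
  | .and f g => PosBool.occurs a f ∨ PosBool.occurs a g
  | .or f g => PosBool.occurs a f ∨ PosBool.occurs a g

/-- The dual of a positive boolean formula (swap `∧`/`∨` and `true`/`false`). -/
def PosBool.dual {α : Type} : PosBool α → PosBool α
  | .tt => .ff
  | .ff => .tt
  | .var a => .var a
  | .and f g => .or (PosBool.dual f) (PosBool.dual g)
  | .or f g => .and (PosBool.dual f) (PosBool.dual g)

/-- Kinds of strata of a two-way HAA. -/
inductive StratKind where
  | neg : StratKind
  | transient : StratKind
  | buchi : StratKind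
  | cobuchi : StratKind
deriving DecidableEq

/-- Data of a two-way hesitant alternating automaton over the alphabet `Sig`:
states, initial state, transition function, backward acceptance condition, and a
strata family (components indexed by `I`, their kinds, acceptance sets and partial
order). -/
structure HAAData (Sig : Type) where
  Q : Type
  q0 : Q
  tr : Q → Sig → PosBool (TDir × Q)
  Fm : Set Q
  I : Type
  strat : Q → I
  kind : I → StratKind
  F : I → Set Q
  le : I → I → Prop

/-- Well-formedness of a two-way HAA: finitely many states; acceptance sets live in
their components and are empty for negative/transient strata; `le` is a partial
order; moves go to `le`-smaller components, transient strata have no self-moves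
(requirement R1); and self-moves are backward in negative strata and forward in all
other strata (requirement R2). -/
def HAAData.IsHAA {Sig : Type} (A : HAAData Sig) : Prop :=
  Finite A.Q ∧
  (∀ i, ∃ q, A.strat q = i) ∧
  (∀ i, A.F i ⊆ {q | A.strat q = i}) ∧
  (∀ i, A.kind i = StratKind.neg ∨ A.kind i = StratKind.transient → A.F i = ∅) ∧
  (∀ i, A.le i i) ∧
  (∀ i j k, A.le i j → A.le j k → A.le i k) ∧
  (∀ i j, A.le i j → A.le j i → i = j) ∧
  (∀ q σ d q', PosBool.occurs (d, q') (A.tr q σ) → A.le (A.strat q') (A.strat q)) ∧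
  (∀ q σ d q', PosBool.occurs (d, q') (A.tr q σ) →
      A.kind (A.strat q) = StratKind.transient → A.strat q' ≠ A.strat q) ∧
  (∀ q σ d q', PosBool.occurs (d, q') (A.tr q σ) → A.strat q' = A.strat q →
      ((A.kind (A.strat q) = StratKind.neg → d = TDir.bwd) ∧
       (A.kind (A.strat q) ≠ StratKind.neg → d = TDir.fwd)))

/-- The effect of a move `(d, ·)` taken at position `j`. -/
def moveEffect (d : TDir) (j : ℕ) : ℤ :=
  match d with
  | .fwd => (j : ℤ) + 1
  | .bwd => (j : ℤ) - 1

/-- A run of a two-way HAA `A` over the word `w` with initial vertex `v0`: a directed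
graph whose vertices live in `({-1} ∪ ℕ) × Q` and whose edges are consistent with
minimal models of the transition function. -/
structure HAARun {Sig : Type} (A : HAAData Sig) (w : ℕ → Sig) (v0 : ℤ × A.Q) where
  V : Set (ℤ × A.Q)
  Ed : ℤ × A.Q → ℤ × A.Q → Prop
  v0_mem : v0 ∈ V
  edge_mem_l : ∀ ⦃u v⦄, Ed u v → u ∈ V
  edge_mem_r : ∀ ⦃u v⦄, Ed u v → v ∈ V
  lower : ∀ v ∈ V, (-1 : ℤ) ≤ v.1
  no_edge_stop : ∀ (q : A.Q) v, ¬ Ed ((-1 : ℤ), q) v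
  consistent : ∀ (j : ℕ) (q : A.Q), ((j : ℤ), q) ∈ V →
    ∃ Y : Set (TDir × A.Q), PosBool.MinModel (A.tr q (w j)) Y ∧
      ∀ v', (Ed ((j : ℤ), q) v' ↔ ∃ d q', (d, q') ∈ Y ∧ v' = (moveEffect d j, q'))

/-- The infinite path `f` eventually gets trapped in the component `i`. -/
def HAAData.TrappedIn {Sig : Type} (A : HAAData Sig) (f : ℕ → ℤ × A.Q) (i : A.I) :
    Prop :=
  ∃ N, ∀ k, N ≤ k → A.strat (f k).2 = i

/-- The infinite path `f` is accepting: it satisfies the Büchi (resp. coBüchi)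
condition of the stratum in which it gets trapped. -/
def HAAData.PathAccepting {Sig : Type} (A : HAAData Sig) (f : ℕ → ℤ × A.Q) : Prop :=
  ∀ i, A.TrappedIn f i →
    (A.kind i = StratKind.buchi → ∀ N, ∃ k, N ≤ k ∧ (f k).2 ∈ A.F i) ∧
    (A.kind i = StratKind.cobuchi → ∃ N, ∀ k, N ≤ k → (f k).2 ∉ A.F i)

/-- A run is accepting if all its infinite paths are accepting and every vertex
`(-1, q)` reachable from the initial vertex has `q` in the backward acceptance
condition. -/
def HAARun.Accepting {Sig : Type} {A : HAAData Sig} {w : ℕ → Sig} {v0 : ℤ × A.Q}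
    (r : HAARun A w v0) : Prop :=
  (∀ f : ℕ → ℤ × A.Q, (∀ k, r.Ed (f k) (f (k + 1))) → A.PathAccepting f) ∧
  (∀ q : A.Q, Relation.ReflTransGen r.Ed v0 ((-1 : ℤ), q) → q ∈ A.Fm)

/-- The pointed language of a two-way HAA: `(w, i) ∈ L_p(A)` iff there is an
accepting `(i, q0)`-run of `A` over `w`. -/
def HAAData.Lp {Sig : Type} (A : HAAData Sig) (w : ℕ → Sig) (i : ℕ) : Prop :=
  ∃ r : HAARun A w ((i : ℤ), A.q0), r.Accepting
/-- `q` is a coBüchi state: it belongs to a coBüchi stratum. -/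
def IsCobuchiState {Sig : Type} (A : HAAData Sig) (q : A.Q) : Prop :=
  A.kind (A.strat q) = StratKind.cobuchi

/-- The size of the stratum of `q`. -/
noncomputable def StratSize {Sig : Type} (A : HAAData Sig) (q : A.Q) : ℕ :=
  Nat.card {q' : A.Q // A.strat q' = A.strat q}

/-- A region of `A`: a triple `(R, O, f)` with `O ⊆ R ⊆ Q` and `f` assigning to
each coBüchi state of `R` a rank of it, even on acceptance sets. -/
def RegionD {Sig : Type} (A : HAAData Sig) : Type :=
  Set A.Q × Set A.Q × (A.Q → ℕ)

def IsRegion {Sig : Type} (A : HAAData Sig) (reg : RegionD A) : Prop :=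
  reg.2.1 ⊆ reg.1 ∧
  ∀ q ∈ reg.1, IsCobuchiState A q →
    (1 ≤ reg.2.2 q ∧ reg.2.2 q ≤ 2 * StratSize A q ∧
      (q ∈ A.F (A.strat q) → Even (reg.2.2 q)))

/-- `q` is accepting with respect to (the `R` and `f` components of) a region. -/
def AccWrt {Sig : Type} (A : HAAData Sig) (R : Set A.Q) (f : A.Q → ℕ) (q : A.Q) :
    Prop :=
  (A.kind (A.strat q) = StratKind.buchi ∧ q ∈ A.F (A.strat q)) ∨
  (IsCobuchiState A q ∧ (q ∈ R → Odd (f q)))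

/-- The infinite sequence of regions `ν` is good with respect to the pointed word
`(w, ℓ)`: initialization, δ-consistency (with the stop region at position `-1`),
the ranking requirement, and the Miyano–Hayashi requirement. -/
def GoodSeq {Sig : Type} (A : HAAData Sig) (w : ℕ → Sig) (ℓ : ℕ)
    (ν : ℕ → RegionD A) : Prop :=
  (∀ i, IsRegion A (ν i)) ∧
  A.q0 ∈ (ν ℓ).1 ∧
  ∀ i : ℕ, ∃ g : A.Q → Set (TDir × A.Q),
    (∀ q ∈ (ν i).1, PosBool.MinModel (A.tr q (w i)) (g q)) ∧
    (∀ q ∈ (ν i).1, ∀ p : A.Q,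
      ((TDir.fwd, p) ∈ g q →
        p ∈ (ν (i + 1)).1 ∧
        (IsCobuchiState A p ∧ A.strat p = A.strat q →
          (ν (i + 1)).2.2 p ≤ (ν i).2.2 q)) ∧
      ((TDir.bwd, p) ∈ g q →
        (i = 0 → p ∈ A.Fm ∧
          (IsCobuchiState A p ∧ A.strat p = A.strat q → 1 ≤ (ν i).2.2 q)) ∧
        (i ≠ 0 → p ∈ (ν (i - 1)).1 ∧
          (IsCobuchiState A p ∧ A.strat p = A.strat q →
            (ν (i - 1)).2.2 p ≤ (ν i).2.2 q)))) ∧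
    (∀ q ∈ (ν i).2.1, ∀ p : A.Q, (TDir.fwd, p) ∈ g q →
      p ∈ (ν (i + 1)).1 → ¬ AccWrt A (ν (i + 1)).1 (ν (i + 1)).2.2 p →
      p ∈ (ν (i + 1)).2.1)

/-- The infinite sequence of regions `ν` is accepting. -/
def AcceptingSeq {Sig : Type} (A : HAAData Sig) (ν : ℕ → RegionD A) : Prop :=
  ∀ N, ∃ i, N ≤ i ∧ (ν i).2.1 = ∅ ∧
    (ν (i + 1)).2.1 =
      (ν (i + 1)).1 \ {q | AccWrt A (ν (i + 1)).1 (ν (i + 1)).2.2 q}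

/-- Satisfaction only depends on the occurring atoms and is monotone in them. -/
theorem PosBool.isSat_mono_of_occurs {α : Type} (f : PosBool α) {Y Z : Set α}
    (h : ∀ a, PosBool.occurs a f → a ∈ Y → a ∈ Z) (hY : PosBool.isSat f Y) :
    PosBool.isSat f Z := by
  induction f with
  | tt => trivial
  | ff => exact hY
  | var a => exact h a rfl hY
  | and f g ihf ihg =>
    exact ⟨ihf (fun a ha => h a (Or.inl ha)) hY.1, ihg (fun a ha => h a (Or.inr ha)) hY.2⟩
  | or f g ihf ihg =>
    rcases hY with hY | hY
    · exact Or.inl (ihf (fun a ha => h a (Or.inl ha)) hY)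
    · exact Or.inr (ihg (fun a ha => h a (Or.inr ha)) hY)

theorem PosBool.MinModel.occurs_of_mem {α : Type} {f : PosBool α} {Y : Set α}
    (h : PosBool.MinModel f Y) {a : α} (ha : a ∈ Y) : PosBool.occurs a f := by
  by_contra hocc
  refine h.2 (Y \ {a}) ⟨Set.sdiff_subset, fun hs => (hs ha).2 rfl⟩ ?_
  refine PosBool.isSat_mono_of_occurs f (fun b hb hbY => ⟨hbY, ?_⟩) h.1
  rintro rfl
  exact hocc hb

/-- König's lemma for a sequence of nonempty sets in a finite type in which every element of a
later set has a predecessor in the previous one. -/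
theorem exists_path_of_forall_pred {Q : Type} [Finite Q] (S : ℕ → Set Q)
    (E : ℕ → Q → Q → Prop) (hne : ∀ i, (S i).Nonempty)
    (hpred : ∀ i, ∀ q ∈ S (i + 1), ∃ p ∈ S i, E i p q) :
    ∃ p : ℕ → Q, ∀ i, p i ∈ S i ∧ E i (p i) (p (i + 1)) := by
  have hfin : ∀ n, ∀ q ∈ S n, ∃ b : ℕ → Q, b n = q ∧ (∀ i ≤ n, b i ∈ S i) ∧
      ∀ i < n, E i (b i) (b (i + 1)) := by
    intro n
    induction n with
    | zero =>
      intro q hq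
      refine ⟨fun _ => q, rfl, fun i hi => ?_, fun i hi => absurd hi (Nat.not_lt_zero i)⟩
      obtain rfl : i = 0 := by omega
      exact hq
    | succ n ih =>
      intro q hq
      obtain ⟨p, hp, hpq⟩ := hpred n q hq
      obtain ⟨b, hbn, hbS, hbE⟩ := ih p hp
      refine ⟨fun i => if i ≤ n then b i else q, by simp, fun i hi => ?_, fun i hi => ?_⟩
      · by_cases h : i ≤ n
        · simpa [h] using hbS i h
        · obtain rfl : i = n + 1 := by omega
          simpa using hq
      · by_cases h : i + 1 ≤ n
        · have h' : i ≤ n := by omega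
          simpa [h, h'] using hbE i (by omega)
        · obtain rfl : i = n := by omega
          simpa [hbn] using hpq
  have hb : ∀ n, ∃ b : ℕ → Q, (∀ i ≤ n, b i ∈ S i) ∧ ∀ i < n, E i (b i) (b (i + 1)) := by
    intro n
    obtain ⟨q, hq⟩ := hne n
    obtain ⟨b, -, hb⟩ := hfin n q hq
    exact ⟨b, hb⟩
  choose b hbS hbE using hb
  have hlim : ∀ i, ∃ q, ∀ᶠ n in (Filter.hyperfilter ℕ : Filter ℕ), b n i = q := by
    intro i
    obtain ⟨q, hq⟩ := Ultrafilter.eq_pure_of_finite ((Filter.hyperfilter ℕ).map fun n => b n i)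
    refine ⟨q, ?_⟩
    have : ({q} : Set Q) ∈ (Filter.hyperfilter ℕ).map fun n => b n i := by
      rw [hq]
      exact Ultrafilter.mem_pure.2 rfl
    exact this
  choose p hp using hlim
  have hlarge : ∀ i, ∀ᶠ n in (Filter.hyperfilter ℕ : Filter ℕ), i < n := fun i =>
    Nat.hyperfilter_le_atTop (Filter.eventually_gt_atTop i)
  refine ⟨p, fun i => ?_⟩
  obtain ⟨n, ⟨hn, hn1⟩, hi⟩ := (((hp i).and (hp (i + 1))).and (hlarge i)).exists
  rw [← hn, ← hn1]
  exact ⟨hbS n i hi.le, hbE n i hi⟩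

/-- If every vertex of a set without dead ends reaches a target inside the set, some infinite
path visits the target infinitely often. -/
theorem exists_path_infinitely_often {V : Type} (E : V → V → Prop) (G F : Set V)
    (hsucc : ∀ v ∈ G, ∃ u ∈ G, E v u)
    (hreach : ∀ v ∈ G, ∃ u ∈ F, Relation.ReflTransGen (fun a b => E a b ∧ b ∈ G) v u)
    {v : V} (hv : v ∈ G) :
    ∃ f : ℕ → V, (∀ k, E (f k) (f (k + 1))) ∧ ∀ N, ∃ k, N ≤ k ∧ f k ∈ F := by
  let P : ℕ → V → Prop := fun n =>
    Nat.rec (fun v => v ∈ F) (fun _ p v => ∃ u, (E v u ∧ u ∈ G) ∧ p u) n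
  have hP : ∀ v ∈ G, ∃ n, P n v := by
    intro v hv
    obtain ⟨u, hu, hvu⟩ := hreach v hv
    clear hv
    induction hvu using Relation.ReflTransGen.head_induction_on with
    | refl => exact ⟨0, hu⟩
    | head hac _ ih =>
      obtain ⟨n, hn⟩ := ih
      exact ⟨n + 1, _, hac, hn⟩
  let d : V → ℕ := fun v => sInf {n | P n v}
  have hnext : ∀ v : G, ∃ u : G, E v u ∧ ((v : V) ∈ F ∨ d u < d v) := by
    rintro ⟨v, hv⟩
    have hd : P (d v) v := Nat.sInf_mem (hP v hv)
    rcases hdv : d v with _ | n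
    · rw [hdv] at hd
      obtain ⟨u, hu, hvu⟩ := hsucc v hv
      exact ⟨⟨u, hu⟩, hvu, Or.inl hd⟩
    · rw [hdv] at hd
      obtain ⟨u, ⟨hvu, hu⟩, hn⟩ := hd
      refine ⟨⟨u, hu⟩, hvu, Or.inr ?_⟩
      have : d u ≤ n := Nat.sInf_le hn
      exact Nat.lt_succ_of_le this
  choose next hE hdec using hnext
  let f : ℕ → G := fun k => next^[k] ⟨v, hv⟩
  have hf : ∀ k, f (k + 1) = next (f k) := fun k => Function.iterate_succ_apply' _ _ _
  refine ⟨fun k => f k, fun k => ?_, fun N => ?_⟩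
  · change E (f k) (f (k + 1))
    rw [hf]
    exact hE _
  · have key : ∀ n N, d (f N) ≤ n → ∃ k, N ≤ k ∧ (f k : V) ∈ F := by
      intro n
      induction n with
      | zero =>
        intro N hN
        rcases hdec (f N) with h | h
        · exact ⟨N, le_rfl, h⟩
        · omega
      | succ n ih =>
        intro N hN
        rcases hdec (f N) with h | h
        · exact ⟨N, le_rfl, h⟩
        · obtain ⟨k, hk, hkF⟩ := ih (N + 1) (by rw [hf]; omega)
          exact ⟨k, by omega, hkF⟩
    exact key _ N le_rfl

/-- Kupferman–Vardi ranks: in a leveled graph all of whose infinite paths visit `F` finitely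
often, vertices of a subgraph having eventually at most `m` vertices outside `F` per level can be
ranked by numbers up to `2 * m` so that ranks are even on `F`, do not increase along edges,
and no infinite path has only even ranks. -/
theorem exists_cobuchi_rank {Q : Type} [Finite Q] (E : ℕ × Q → ℕ × Q → Prop)
    (hlev : ∀ u v, E u v → v.1 = u.1 + 1) (F : Set (ℕ × Q))
    (hF : ∀ f : ℕ → ℕ × Q, (∀ k, E (f k) (f (k + 1))) → ∃ N, ∀ k, N ≤ k → f k ∉ F)
    (m : ℕ) (G : Set (ℕ × Q))
    (hG : ∃ N, ∀ j, N ≤ j → {q | (j, q) ∈ G ∧ (j, q) ∉ F}.ncard ≤ m) :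
    ∃ r : ℕ × Q → ℕ, (∀ v ∈ G, r v ≤ 2 * m) ∧ (∀ v ∈ G, v ∈ F → Even (r v)) ∧
      (∀ u ∈ G, ∀ v ∈ G, E u v → r v ≤ r u) ∧
      ∀ f : ℕ → ℕ × Q, (∀ k, f k ∈ G ∧ E (f k) (f (k + 1))) → ∃ k, Odd (r (f k)) := by
  classical
  have hlevel : ∀ f : ℕ → ℕ × Q, (∀ k, E (f k) (f (k + 1))) → ∀ k, (f k).1 = (f 0).1 + k := by
    intro f hf k
    induction k with
    | zero => rfl
    | succ k ih => rw [hlev _ _ (hf k), ih, add_assoc]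
  induction m generalizing G with
  | zero =>
    refine ⟨fun _ => 0, by simp, by simp, by simp, fun f hf => ?_⟩
    exfalso
    obtain ⟨N, hN⟩ := hG
    obtain ⟨M, hM⟩ := hF f fun k => (hf k).2
    have h1 := hN (f (max N M)).1 (by
      rw [hlevel f (fun k => (hf k).2)]
      have := le_max_left N M
      omega)
    rw [Nat.le_zero, Set.ncard_eq_zero (Set.toFinite _)] at h1
    have h2 : (f (max N M)).2 ∈ {q | ((f (max N M)).1, q) ∈ G ∧ ((f (max N M)).1, q) ∉ F} :=
      ⟨(hf _).1, hM _ (le_max_right N M)⟩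
    rw [h1] at h2
    exact h2
  | succ m ih =>
    let Inf : Set (ℕ × Q) := {v | ∃ f : ℕ → ℕ × Q, f 0 = v ∧ ∀ k, f k ∈ G ∧ E (f k) (f (k + 1))}
    have hInfG : ∀ v ∈ Inf, v ∈ G := by
      rintro v ⟨f, rfl, hf⟩
      exact (hf 0).1
    have hpathInf : ∀ f : ℕ → ℕ × Q, (∀ k, f k ∈ G ∧ E (f k) (f (k + 1))) → ∀ k, f k ∈ Inf :=
      fun f hf k => ⟨fun n => f (k + n), rfl, fun n => hf (k + n)⟩
    have hInfPred : ∀ u ∈ G, ∀ v ∈ Inf, E u v → u ∈ Inf := by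
      rintro u hu v ⟨f, rfl, hf⟩ huv
      refine ⟨fun n => Nat.casesOn n u f, rfl, fun k => ?_⟩
      cases k with
      | zero => exact ⟨hu, huv⟩
      | succ k => exact hf k
    let Free : Set (ℕ × Q) :=
      {v | v ∈ Inf ∧ ∀ u, Relation.ReflTransGen (fun a b => E a b ∧ b ∈ Inf) v u → u ∉ F}
    have hFreeSucc : ∀ u ∈ Free, ∀ v ∈ Inf, E u v → v ∈ Free := fun u hu v hv huv =>
      ⟨hv, fun x hx => hu.2 x (Relation.ReflTransGen.head ⟨huv, hv⟩ hx)⟩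
    have hFreePath : ∀ f : ℕ → ℕ × Q, (∀ k, f k ∈ G ∧ E (f k) (f (k + 1))) → f 0 ∈ Free →
        ∀ k, f k ∈ Free := by
      intro f hf h0 k
      induction k with
      | zero => exact h0
      | succ k ih => exact hFreeSucc _ ih _ (hpathInf f hf _) (hf k).2
    rcases Set.eq_empty_or_nonempty Free with hFree | ⟨v, hv⟩
    · refine ⟨fun _ => 0, by simp, by simp, by simp, fun f hf => ?_⟩
      exfalso
      obtain ⟨p, hp, hpF⟩ := exists_path_infinitely_often E Inf F
        (by
          rintro v ⟨f, rfl, hf⟩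
          exact ⟨f 1, hpathInf f hf 1, (hf 0).2⟩)
        (by
          intro v hv
          by_contra! hcon
          have : v ∈ Free := ⟨hv, fun u hu huF => hcon u huF hu⟩
          rw [hFree] at this
          exact this)
        (hpathInf f hf 0)
      obtain ⟨N, hN⟩ := hF p hp
      obtain ⟨k, hk, hkF⟩ := hpF N
      exact hN k hk hkF
    · obtain ⟨N, hN⟩ := hG
      obtain ⟨f, hf0, hf⟩ := hv.1
      have hfFree := hFreePath f hf (by rw [hf0]; exact hv)
      obtain ⟨r, hr_le, hr_even, hr_mono, hr_path⟩ := ih (Inf \ Free) ⟨max N v.1, fun j hj => by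
        have h1 := hN j (le_trans (le_max_left _ _) hj)
        have hlt : {q | (j, q) ∈ Inf \ Free ∧ (j, q) ∉ F}.ncard <
            {q | (j, q) ∈ G ∧ (j, q) ∉ F}.ncard := by
          refine Set.ncard_lt_ncard ⟨fun q hq => ⟨hInfG _ hq.1.1, hq.2⟩, fun hsub => ?_⟩
            (Set.toFinite _)
          have hjv : v.1 ≤ j := le_trans (le_max_right _ _) hj
          have hlv : (f (j - v.1)).1 = j := by
            rw [hlevel f (fun k => (hf k).2), hf0]
            omega
          have hx : (j, (f (j - v.1)).2) = f (j - v.1) := Prod.ext hlv.symm rfl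
          have hq : (f (j - v.1)).2 ∈ {q | (j, q) ∈ G ∧ (j, q) ∉ F} := by
            change (_ ∈ G) ∧ (_ ∉ F)
            rw [hx]
            exact ⟨(hf _).1, (hfFree _).2 _ Relation.ReflTransGen.refl⟩
          have := (hsub hq).1.2
          rw [hx] at this
          exact this (hfFree _)
        omega⟩
      refine ⟨fun v => if v ∈ Inf then if v ∈ Free then 1 else r v + 2 else 0, ?_, ?_, ?_, ?_⟩
      · intro v hv
        by_cases h1 : v ∈ Inf
        · by_cases h2 : v ∈ Free
          · simp only [h1, h2, if_true]
            omega
          · have := hr_le v ⟨h1, h2⟩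
            simp only [h1, h2, if_true, if_false]
            omega
        · simp [h1]
      · intro v hv hvF
        by_cases h1 : v ∈ Inf
        · by_cases h2 : v ∈ Free
          · exact absurd hvF (h2.2 v Relation.ReflTransGen.refl)
          · simpa [h1, h2, Nat.even_add] using hr_even v ⟨h1, h2⟩ hvF
        · simp [h1]
      · intro u hu v hv huv
        by_cases h1 : v ∈ Inf
        · have h1' := hInfPred u hu v h1 huv
          by_cases h2 : v ∈ Free
          · by_cases h2' : u ∈ Free
            · simp [h1, h2, h1', h2']
            · simp [h1, h2, h1', h2']
          · have h2' : u ∉ Free := fun h => h2 (hFreeSucc u h v h1 huv)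
            simpa [h1, h2, h1', h2'] using hr_mono u ⟨h1', h2'⟩ v ⟨h1, h2⟩ huv
        · simp [h1]
      · intro p hp
        have hpI := hpathInf p hp
        by_cases h : ∃ k, p k ∈ Free
        · obtain ⟨k, hk⟩ := h
          exact ⟨k, by simp [hpI k, hk]⟩
        · push Not at h
          obtain ⟨k, hk⟩ := hr_path p fun k => ⟨⟨hpI k, h k⟩, (hp k).2⟩
          refine ⟨k, ?_⟩
          simp only [hpI k, h k, if_true, if_false]
          exact hk.add_even even_two

section

variable {Sig : Type} {A : HAAData Sig} {w : ℕ → Sig}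

/-- Any edge out of a vertex of a run stems from an atom of the transition formula. -/
theorem HAARun.exists_occurs {v0 : ℤ × A.Q} (r : HAARun A w v0) {j : ℕ} {q : A.Q} {v : ℤ × A.Q}
    (h : r.Ed ((j : ℤ), q) v) :
    ∃ d, PosBool.occurs (d, v.2) (A.tr q (w j)) ∧ v.1 = moveEffect d j := by
  obtain ⟨Y, hY, hYE⟩ := r.consistent j q (r.edge_mem_l h)
  obtain ⟨d, q', hd, rfl⟩ := (hYE v).1 h
  exact ⟨d, hY.occurs_of_mem hd, rfl⟩

theorem HAARun.mem_of_reachable {v0 : ℤ × A.Q} (r : HAARun A w v0) {v : ℤ × A.Q}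
    (h : Relation.ReflTransGen r.Ed v0 v) : v ∈ r.V := by
  rcases Relation.ReflTransGen.cases_tail h with rfl | ⟨u, -, hu⟩
  · exact r.v0_mem
  · exact r.edge_mem_r hu

/-- Ranks witnessing that all paths trapped in a coBüchi stratum are accepting. -/
theorem HAARun.exists_stratum_rank (hA : A.IsHAA) {v0 : ℤ × A.Q} (r : HAARun A w v0)
    (hr : r.Accepting) {c : A.I} (hc : A.kind c = StratKind.cobuchi) :
    ∃ ρ : ℕ × A.Q → ℕ,
      (∀ v, A.strat v.2 = c → 1 ≤ ρ v ∧ ρ v ≤ 2 * StratSize A v.2) ∧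
      (∀ v, A.strat v.2 = c → v.2 ∈ A.F c → Even (ρ v)) ∧
      (∀ u v : ℕ × A.Q, A.strat u.2 = c → A.strat v.2 = c →
        r.Ed ((u.1 : ℤ), u.2) ((v.1 : ℤ), v.2) → ρ v ≤ ρ u) ∧
      ∀ f : ℕ → ℕ × A.Q, (∀ k, A.strat (f k).2 = c) →
        (∀ k, r.Ed (((f k).1 : ℤ), (f k).2) (((f (k + 1)).1 : ℤ), (f (k + 1)).2)) →
        ∃ k, Odd (ρ (f k)) := by
  obtain ⟨hfin, -, hFsub, -, -, -, -, -, -, hR2⟩ := hA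
  have hsize : ∀ v : ℕ × A.Q, A.strat v.2 = c → StratSize A v.2 = {q | A.strat q = c}.ncard := by
    rintro v rfl
    rfl
  have hpos : ∀ v : ℕ × A.Q, A.strat v.2 = c → 0 < {q | A.strat q = c}.ncard := fun v hv =>
    (Set.ncard_pos (Set.toFinite _)).2 ⟨v.2, hv⟩
  by_cases hFc : (A.F c).Nonempty
  · obtain ⟨q1, hq1⟩ := hFc
    obtain ⟨ρ, hle, heven, hmono, hodd⟩ := exists_cobuchi_rank
      (fun u v : ℕ × A.Q => r.Ed ((u.1 : ℤ), u.2) ((v.1 : ℤ), v.2) ∧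
        A.strat u.2 = c ∧ A.strat v.2 = c)
      (by
        rintro u v ⟨huv, hu, hv⟩
        obtain ⟨d, hocc, hd⟩ := r.exists_occurs huv
        have hfwd := (hR2 _ _ _ _ hocc (hv.trans hu.symm)).2 (by rw [hu, hc]; decide)
        subst hfwd
        simp only [moveEffect] at hd
        exact_mod_cast hd)
      {v | v.2 ∈ A.F c}
      (fun f hf => (hr.1 (fun k => (((f k).1 : ℤ), (f k).2)) (fun k => (hf k).1) c
        ⟨0, fun k _ => (hf k).2.1⟩).2 hc)
      ({q | A.strat q = c}.ncard - 1) {v | A.strat v.2 = c}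
      ⟨0, fun j _ => by
        refine Nat.le_sub_one_of_lt (Set.ncard_lt_ncard ⟨fun q hq => hq.1, fun hsub => ?_⟩
          (Set.toFinite _))
        exact (hsub (hFsub c hq1)).2 hq1⟩
    refine ⟨fun v => ρ v + 2, fun v hv => ⟨Nat.le_add_left _ _, ?_⟩, fun v hv hvF => ?_,
      fun u v hu hv huv => ?_, fun f hf hfE => ?_⟩
    · have h1 := hle v hv
      have h2 := hpos v hv
      rw [hsize v hv]
      change ρ v + 2 ≤ _
      omega
    · exact (heven v hv hvF).add even_two
    · exact Nat.add_le_add_right (hmono u hu v hv ⟨huv, hu, hv⟩) 2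
    · obtain ⟨k, hk⟩ := hodd f fun k => ⟨hf k, hfE k, hf k, hf (k + 1)⟩
      exact ⟨k, hk.add_even even_two⟩
  · refine ⟨fun _ => 1, fun v hv => ⟨le_rfl, ?_⟩, fun v _ hvF => absurd ⟨_, hvF⟩ hFc,
      fun _ _ _ _ _ => le_rfl, fun _ _ _ => ⟨0, odd_one⟩⟩
    have h2 := hpos v hv
    rw [hsize v hv]
    change 1 ≤ _
    omega

/-- The strata along an infinite sequence of moves are eventually constant. -/
theorem HAAData.IsHAA.exists_trapped (hA : A.IsHAA) (p : ℕ → A.Q)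
    (hp : ∀ k, A.le (A.strat (p (k + 1))) (A.strat (p k))) :
    ∃ N, ∀ k, N ≤ k → A.strat (p k) = A.strat (p N) := by
  obtain ⟨hfin, hsurj, -, -, hrefl, htrans, hanti, -⟩ := hA
  let lt : A.I → A.I → Prop := fun i j => A.le i j ∧ i ≠ j
  have : Finite A.I := Finite.of_surjective A.strat hsurj
  have : IsTrans A.I lt := ⟨fun i j k hij hjk => ⟨htrans _ _ _ hij.1 hjk.1, by
    rintro rfl
    exact hij.2 (hanti _ _ hij.1 hjk.1)⟩⟩
  have : Std.Irrefl lt := ⟨fun i hi => hi.2 rfl⟩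
  have hwf : WellFounded lt := Finite.wellFounded_of_trans_of_irrefl lt
  obtain ⟨_, ⟨N, rfl⟩, hN⟩ :=
    hwf.has_min (Set.range fun k => A.strat (p k)) ⟨_, Set.mem_range_self 0⟩
  refine ⟨N, fun k hk => ?_⟩
  have hle : A.le (A.strat (p k)) (A.strat (p N)) := by
    induction k, hk using Nat.le_induction with
    | base => exact hrefl _
    | succ k _ ih => exact htrans _ _ _ (hp k) ih
  by_contra hne
  exact hN _ (Set.mem_range_self k) ⟨hle, hne⟩

/-- A good accepting sequence of regions has no infinite forward path of non-accepting states. -/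
theorem AcceptingSeq.false_of_path {ν : ℕ → RegionD A} (hν : AcceptingSeq A ν)
    (g : ℕ → A.Q → Set (TDir × A.Q))
    (hMH : ∀ i, ∀ q ∈ (ν i).2.1, ∀ p : A.Q, (TDir.fwd, p) ∈ g i q →
      p ∈ (ν (i + 1)).1 → ¬ AccWrt A (ν (i + 1)).1 (ν (i + 1)).2.2 p → p ∈ (ν (i + 1)).2.1)
    (j : ℕ) (p : ℕ → A.Q) (hR : ∀ k, p k ∈ (ν (j + k)).1)
    (hacc : ∀ k, ¬ AccWrt A (ν (j + k)).1 (ν (j + k)).2.2 (p k))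
    (hmove : ∀ k, (TDir.fwd, p (k + 1)) ∈ g (j + k) (p k)) : False := by
  obtain ⟨i, hi, -, hreset⟩ := hν j
  obtain ⟨k0, hk0⟩ : ∃ k0, i + 1 = j + k0 := ⟨i + 1 - j, by omega⟩
  rw [hk0] at hreset
  have hO : ∀ k, k0 ≤ k → p k ∈ (ν (j + k)).2.1 := by
    intro k hk
    induction k, hk using Nat.le_induction with
    | base =>
      rw [hreset]
      exact ⟨hR k0, hacc k0⟩
    | succ k _ ih => exact hMH _ _ ih _ (hmove k) (hR (k + 1)) (hacc (k + 1))
  obtain ⟨i', hi', hempty, -⟩ := hν (i + 1)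
  obtain ⟨k, rfl⟩ : ∃ k, i' = j + k := ⟨i' - j, by omega⟩
  have := hO k (by omega)
  rw [hempty] at this
  exact this

/-- The run read off from a good sequence of regions. -/
theorem GoodSeq.lp_of_accepting (hA : A.IsHAA) {ℓ : ℕ} {ν : ℕ → RegionD A}
    (hgood : GoodSeq A w ℓ ν) (hν : AcceptingSeq A ν) : A.Lp w ℓ := by
  obtain ⟨hreg, hinit, hg⟩ := hgood
  choose g hmin hδ hMH using hg
  obtain ⟨hfin, -, -, -, -, -, -, -, -, hR2⟩ := hA
  let V : Set (ℤ × A.Q) :=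
    {v | (∃ j : ℕ, v.1 = j ∧ v.2 ∈ (ν j).1) ∨ (v.1 = -1 ∧ v.2 ∈ A.Fm)}
  let Ed : ℤ × A.Q → ℤ × A.Q → Prop := fun u v =>
    ∃ j : ℕ, u.1 = j ∧ u.2 ∈ (ν j).1 ∧ ∃ d, (d, v.2) ∈ g j u.2 ∧ v.1 = moveEffect d j
  have hEdV : ∀ u v, Ed u v → v ∈ V := by
    rintro ⟨_, q⟩ ⟨_, p⟩ ⟨j, rfl, hq, d, hd, rfl⟩
    cases d with
    | fwd => exact Or.inl ⟨j + 1, by simp [moveEffect], ((hδ j q hq p).1 hd).1⟩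
    | bwd =>
      rcases Nat.eq_zero_or_pos j with rfl | hj
      · exact Or.inr ⟨by simp [moveEffect], (((hδ 0 q hq p).2 hd).1 rfl).1⟩
      · refine Or.inl ⟨j - 1, ?_, (((hδ j q hq p).2 hd).2 hj.ne').1⟩
        simp only [moveEffect]
        omega
  have hVR : ∀ (j : ℕ) (q : A.Q), ((j : ℤ), q) ∈ V → q ∈ (ν j).1 := by
    rintro j q (⟨j', hj', hq⟩ | ⟨hj, -⟩)
    · obtain rfl : j = j' := Int.ofNat_inj.1 hj'
      exact hq
    · simp only at hj
      omega
  let r : HAARun A w ((ℓ : ℤ), A.q0) :=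
    { V := V
      Ed := Ed
      v0_mem := Or.inl ⟨ℓ, rfl, hinit⟩
      edge_mem_l := by
        rintro u v ⟨j, hj, hu, -⟩
        exact Or.inl ⟨j, hj, hu⟩
      edge_mem_r := fun u v h => hEdV u v h
      lower := by
        rintro v (⟨j, hj, -⟩ | ⟨hj, -⟩) <;> omega
      no_edge_stop := by
        rintro q v ⟨j, hj, -⟩
        simp only at hj
        omega
      consistent := by
        intro j q hq
        have hqR := hVR j q hq
        refine ⟨g j q, hmin j q hqR, ?_⟩
        rintro ⟨h, p⟩
        constructor
        · rintro ⟨j', hj', -, d, hd, hh⟩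
          obtain rfl : j = j' := Int.ofNat_inj.1 hj'
          exact ⟨d, p, hd, Prod.ext hh rfl⟩
        · rintro ⟨d, q', hd, heq⟩
          obtain ⟨rfl, rfl⟩ := Prod.mk.inj heq
          exact ⟨j, rfl, hqR, d, hd, rfl⟩ }
  refine ⟨r, ?_, ?_⟩
  · intro f hf c hc
    choose j hj hjR d hd hdj using hf
    obtain ⟨N, hN⟩ := hc
    have hfwd : A.kind c ≠ StratKind.neg → ∀ k, N ≤ k →
        (TDir.fwd, (f (k + 1)).2) ∈ g (j k) (f k).2 ∧ j (k + 1) = j k + 1 := by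
      intro hneg k hk
      have hs : A.strat (f (k + 1)).2 = A.strat (f k).2 := by
        rw [hN k hk, hN (k + 1) (by omega)]
      have hdk := (hR2 _ _ _ _ ((hmin _ _ (hjR k)).occurs_of_mem (hd k)) hs).2
        (by rwa [hN k hk])
      have h1 := hd k
      have h2 := hdj k
      rw [hdk] at h1 h2
      refine ⟨h1, ?_⟩
      rw [hj (k + 1)] at h2
      simp only [moveEffect] at h2
      exact_mod_cast h2
    have hfalse : A.kind c ≠ StratKind.neg → ∀ M, N ≤ M →
        (∀ k, M ≤ k → ¬ AccWrt A (ν (j k)).1 (ν (j k)).2.2 (f k).2) → False := by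
      intro hneg M hM hacc
      have hjM : ∀ k, j (M + k) = j M + k := by
        intro k
        induction k with
        | zero => rfl
        | succ k ih => rw [← add_assoc, (hfwd hneg (M + k) (by omega)).2, ih, add_assoc]
      refine hν.false_of_path g hMH (j M) (fun k => (f (M + k)).2) (fun k => ?_) (fun k => ?_)
        (fun k => ?_)
      · rw [← hjM]
        exact hjR (M + k)
      · rw [← hjM]
        exact hacc (M + k) (by omega)
      · rw [← hjM]
        exact (hfwd hneg (M + k) (by omega)).1
    constructor
    · intro hb M
      by_contra! hcon
      refine hfalse (by rw [hb]; decide) (max M N) (le_max_right _ _) fun k hk => ?_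
      have hs := hN k (le_trans (le_max_right _ _) hk)
      rintro (⟨-, h⟩ | ⟨h, -⟩)
      · rw [hs] at h
        exact hcon k (le_trans (le_max_left _ _) hk) h
      · rw [IsCobuchiState, hs, hb] at h
        cases h
    · intro hcb
      have hneg : A.kind c ≠ StratKind.neg := by rw [hcb]; decide
      have hIs : ∀ k, N ≤ k → IsCobuchiState A (f k).2 := fun k hk => by
        rw [IsCobuchiState, hN k hk, hcb]
      let rank : ℕ → ℕ := fun k => (ν (j (N + k))).2.2 (f (N + k)).2
      have hanti : Antitone rank := by
        refine antitone_nat_of_succ_le fun k => ?_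
        obtain ⟨h1, h2⟩ := hfwd hneg (N + k) (by omega)
        have h3 := ((hδ _ _ (hjR (N + k)) _).1 h1).2
          ⟨hIs _ (by omega), by rw [hN _ (by omega), hN _ (by omega)]⟩
        change (ν (j (N + k + 1))).2.2 (f (N + k + 1)).2 ≤ _
        rw [h2]
        exact h3
      obtain ⟨M, hM⟩ : ∃ M, ∀ k, M ≤ k → rank k = rank M := by
        obtain ⟨_, ⟨M, rfl⟩, hM⟩ :=
          Nat.lt_wfRel.wf.has_min (Set.range rank) ⟨_, Set.mem_range_self 0⟩
        exact ⟨M, fun k hk =>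
          le_antisymm (hanti hk) (not_lt.1 (hM _ (Set.mem_range_self k)))⟩
      by_contra! hcon
      obtain ⟨k0, hk0, hk0F⟩ := hcon (N + M)
      have heven : Even (rank M) := by
        rw [← hM (k0 - N) (by omega)]
        change Even ((ν (j (N + (k0 - N)))).2.2 (f (N + (k0 - N))).2)
        rw [show N + (k0 - N) = k0 by omega]
        refine ((hreg (j k0)).2 _ (hjR k0) (hIs k0 (by omega))).2.2 ?_
        rwa [hN k0 (by omega)]
      refine hfalse hneg (N + M) (by omega) fun k hk => ?_
      rintro (⟨h, -⟩ | ⟨-, h⟩)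
      · rw [hN k (by omega), hcb] at h
        cases h
      · have hodd := h (hjR k)
        have hrk : rank (k - N) = (ν (j k)).2.2 (f k).2 := by
          change (ν (j (N + (k - N)))).2.2 (f (N + (k - N))).2 = _
          rw [show N + (k - N) = k by omega]
        rw [← hrk, hM _ (by omega)] at hodd
        exact (Nat.not_odd_iff_even.2 heven) hodd
  · intro q hq
    rcases r.mem_of_reachable hq with ⟨j, hj, -⟩ | ⟨-, hqF⟩
    · simp only at hj
      omega
    · exact hqF

/-- An accepting run yields a good accepting sequence of regions. -/
theorem HAARun.exists_goodSeq (hA : A.IsHAA) {ℓ : ℕ} (r : HAARun A w ((ℓ : ℤ), A.q0))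
    (hr : r.Accepting) : ∃ ν : ℕ → RegionD A, GoodSeq A w ℓ ν ∧ AcceptingSeq A ν := by
  classical
  have hA' := hA
  obtain ⟨hfin, -, -, -, -, -, -, hR1, htransient, hR2⟩ := hA
  have hY : ∀ (j : ℕ) (q : A.Q), ∃ Y : Set (TDir × A.Q), ((j : ℤ), q) ∈ r.V →
      PosBool.MinModel (A.tr q (w j)) Y ∧
      ∀ v', (r.Ed ((j : ℤ), q) v' ↔ ∃ d q', (d, q') ∈ Y ∧ v' = (moveEffect d j, q')) := by
    intro j q
    by_cases h : ((j : ℤ), q) ∈ r.V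
    · obtain ⟨Y, hY⟩ := r.consistent j q h
      exact ⟨Y, fun _ => hY⟩
    · exact ⟨∅, fun h' => absurd h' h⟩
  choose g hg using hY
  have hρ : ∀ c, ∃ ρ : ℕ × A.Q → ℕ, A.kind c = StratKind.cobuchi →
      (∀ v, A.strat v.2 = c → 1 ≤ ρ v ∧ ρ v ≤ 2 * StratSize A v.2) ∧
      (∀ v, A.strat v.2 = c → v.2 ∈ A.F c → Even (ρ v)) ∧
      (∀ u v : ℕ × A.Q, A.strat u.2 = c → A.strat v.2 = c →
        r.Ed ((u.1 : ℤ), u.2) ((v.1 : ℤ), v.2) → ρ v ≤ ρ u) ∧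
      ∀ f : ℕ → ℕ × A.Q, (∀ k, A.strat (f k).2 = c) →
        (∀ k, r.Ed (((f k).1 : ℤ), (f k).2) (((f (k + 1)).1 : ℤ), (f (k + 1)).2)) →
        ∃ k, Odd (ρ (f k)) := by
    intro c
    by_cases hc : A.kind c = StratKind.cobuchi
    · obtain ⟨ρ, h⟩ := r.exists_stratum_rank hA' hr hc
      exact ⟨ρ, fun _ => h⟩
    · exact ⟨fun _ => 0, fun h => absurd h hc⟩
  choose ρ hρ using hρ
  let R : ℕ → Set A.Q := fun j =>
    {q | Relation.ReflTransGen r.Ed ((ℓ : ℤ), A.q0) ((j : ℤ), q)}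
  have hRV : ∀ j, ∀ q ∈ R j, ((j : ℤ), q) ∈ r.V := fun j q hq => r.mem_of_reachable hq
  let rank : ℕ → A.Q → ℕ := fun j q => ρ (A.strat q) (j, q)
  let T : ℕ → Set A.Q := fun j => R j \ {q | AccWrt A (R j) (rank j) q}
  let step : ℕ → Set A.Q → Set A.Q := fun i o =>
    if o = ∅ then T (i + 1) else {p | p ∈ T (i + 1) ∧ ∃ q ∈ o, (TDir.fwd, p) ∈ g i q}
  let O : ℕ → Set A.Q := fun j => Nat.rec ∅ step j
  have hOsucc_of_empty : ∀ i, O i = ∅ → O (i + 1) = T (i + 1) := fun i h => if_pos h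
  have hOsucc_of_ne : ∀ i, O i ≠ ∅ →
      O (i + 1) = {p | p ∈ T (i + 1) ∧ ∃ q ∈ O i, (TDir.fwd, p) ∈ g i q} := fun i h => if_neg h
  have hOT : ∀ i, O i ⊆ T i := by
    intro i
    cases i with
    | zero => exact Set.empty_subset _
    | succ i =>
      rcases eq_or_ne (O i) ∅ with h | h
      · rw [hOsucc_of_empty i h]
      · rw [hOsucc_of_ne i h]
        exact fun p hp => hp.1
  have hedge : ∀ i, ∀ q ∈ R i, ∀ d p, (d, p) ∈ g i q → r.Ed ((i : ℤ), q) (moveEffect d i, p) :=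
    fun i q hq d p h => ((hg i q (hRV i q hq)).2 _).2 ⟨d, p, h, rfl⟩
  have hocc : ∀ i, ∀ q ∈ R i, ∀ d p, (d, p) ∈ g i q → PosBool.occurs (d, p) (A.tr q (w i)) :=
    fun i q hq d p h => (hg i q (hRV i q hq)).1.occurs_of_mem h
  have hfwdEdge : ∀ i, ∀ q ∈ R i, ∀ p, (TDir.fwd, p) ∈ g i q →
      r.Ed ((i : ℤ), q) (((i + 1 : ℕ) : ℤ), p) := by
    intro i q hq p h
    have := hedge i q hq _ p h
    simpa only [moveEffect, Nat.cast_add, Nat.cast_one] using this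
  have hno_bwd : ∀ i, ∀ q ∈ R i, ∀ p, (TDir.bwd, p) ∈ g i q →
      ¬ (IsCobuchiState A p ∧ A.strat p = A.strat q) := by
    rintro i q hq p h ⟨hp, hpq⟩
    have := (hR2 _ _ _ _ (hocc i q hq _ p h) hpq).2 (by
      rw [← hpq]
      rw [IsCobuchiState] at hp
      rw [hp]
      decide)
    cases this
  refine ⟨fun j => (R j, O j, rank j), ⟨fun j => ⟨fun q hq => (hOT j hq).1, ?_⟩,
    Relation.ReflTransGen.refl, fun i => ⟨g i, fun q hq => (hg i q (hRV i q hq)).1, ?_, ?_⟩⟩, ?_⟩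
  · intro q _ hcb
    obtain ⟨h1, h2, -⟩ := hρ _ hcb
    exact ⟨(h1 (j, q) rfl).1, (h1 (j, q) rfl).2, h2 (j, q) rfl⟩
  · intro q hq p
    refine ⟨fun h => ⟨hq.tail (hfwdEdge i q hq p h), ?_⟩, fun h => ⟨?_, ?_⟩⟩
    · rintro ⟨hcb, hpq⟩
      have := (hρ _ hcb).2.2.1 (i, q) (i + 1, p) hpq.symm rfl (hfwdEdge i q hq p h)
      change ρ (A.strat p) (i + 1, p) ≤ ρ (A.strat q) (i, q)
      rwa [← hpq]
    · rintro rfl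
      refine ⟨hr.2 p ?_, fun hp => absurd hp (hno_bwd 0 q hq p h)⟩
      have := hedge 0 q hq _ p h
      simp only [moveEffect, Nat.cast_zero, zero_sub] at this
      exact Relation.ReflTransGen.tail hq this
    · intro hi
      refine ⟨?_, fun hp => absurd hp (hno_bwd i q hq p h)⟩
      have := hedge i q hq _ p h
      have hcast : moveEffect TDir.bwd i = ((i - 1 : ℕ) : ℤ) := by
        simp only [moveEffect]
        omega
      rw [hcast] at this
      exact Relation.ReflTransGen.tail hq this
  · intro q hq p h hpR hpacc
    change p ∈ O (i + 1)
    have hne : O i ≠ ∅ := Set.nonempty_iff_ne_empty.1 ⟨q, hq⟩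
    rw [hOsucc_of_ne _ hne]
    exact ⟨⟨hpR, hpacc⟩, q, hq, h⟩
  · intro N
    rcases Classical.em (∃ i, N ≤ i ∧ O i = ∅) with ⟨i, hi, hOi⟩ | hex
    · exact ⟨i, hi, hOi, hOsucc_of_empty i hOi⟩
    · exfalso
      have hex : ∀ i, N ≤ i → (O i).Nonempty := fun i hi =>
        Set.nonempty_iff_ne_empty.2 fun h => hex ⟨i, hi, h⟩
      obtain ⟨p, hp⟩ := exists_path_of_forall_pred (fun k => O (N + k))
        (fun k q q' => (TDir.fwd, q') ∈ g (N + k) q)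
        (fun k => hex (N + k) (by omega))
        (by
          intro k q hq
          have hne := Set.nonempty_iff_ne_empty.1 (hex (N + k) (by omega))
          change q ∈ O (N + k + 1) at hq
          rw [hOsucc_of_ne _ hne] at hq
          exact hq.2)
      have hpT : ∀ k, p k ∈ T (N + k) := fun k => hOT _ (hp k).1
      have hpocc : ∀ k, PosBool.occurs (TDir.fwd, p (k + 1)) (A.tr (p k) (w (N + k))) :=
        fun k => hocc _ _ (hpT k).1 _ _ (hp k).2
      have hpE : ∀ k, r.Ed (((N + k : ℕ) : ℤ), p k) (((N + k + 1 : ℕ) : ℤ), p (k + 1)) :=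
        fun k => hfwdEdge _ _ (hpT k).1 _ (hp k).2
      obtain ⟨M, hM⟩ := hA'.exists_trapped p fun k => hR1 _ _ _ _ (hpocc k)
      have hs : A.strat (p (M + 1)) = A.strat (p M) := hM _ (by omega)
      rcases hkind : A.kind (A.strat (p M)) with _ | _ | _ | _
      · have := (hR2 _ _ _ _ (hpocc M) hs).1 hkind
        cases this
      · exact htransient _ _ _ _ (hpocc M) hkind hs
      · obtain ⟨k, hk, hkF⟩ := (hr.1 (fun k => (((N + k : ℕ) : ℤ), p k)) hpE (A.strat (p M))
          ⟨M, hM⟩).1 hkind M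
        exact (hpT k).2 (Or.inl ⟨by rw [hM k hk, hkind], by rw [hM k hk]; exact hkF⟩)
      · obtain ⟨k, hk⟩ := (hρ _ hkind).2.2.2 (fun k => (N + (M + k), p (M + k)))
          (fun k => hM _ (by omega)) (fun k => hpE (M + k))
        have hsk := hM (M + k) (by omega)
        refine (hpT (M + k)).2 (Or.inr ⟨by rw [IsCobuchiState, hsk, hkind], fun _ => ?_⟩)
        change Odd (ρ (A.strat (p (M + k))) (N + (M + k), p (M + k)))
        rw [hsk]
        exact hk

end

/-- **Characterization lemma for two-way HAA**: `(w, ℓ) ∈ L_p(A)` iff there is an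
accepting infinite sequence of regions of `A` which is good w.r.t. `(w, ℓ)`. -/
theorem haa_region_characterization (Sig : Type) (A : HAAData Sig) (hA : A.IsHAA)
    (w : ℕ → Sig) (ℓ : ℕ) :
    A.Lp w ℓ ↔ ∃ ν : ℕ → RegionD A, GoodSeq A w ℓ ν ∧ AcceptingSeq A ν :=
  ⟨fun ⟨r, hr⟩ => r.exists_goodSeq hA hr, fun ⟨_, hgood, hν⟩ => hgood.lp_of_accepting hA hν⟩
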